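/- Let ε > 0 be a sufficiently small constant and p = (1+ε)/n. Then with high probability G ~ G(n,p) contains a path on at least ε²n/5 vertices. -/

import Mathlib

open Filter
open scoped Classical

/-- The probability, in the Erdős–Rényi binomial random graph `G(n,p)`,
of the event `P`. -/
noncomputable def erProb (n : ℕ) (p : ℝ) (P : SimpleGraph (Fin n) → Prop) : ℝ :=
  ∑ G : SimpleGraph (Fin n),
    if P G then
      p ^ Nat.card G.edgeSet * (1 - p) ^ (n.choose 2 - Nat.card G.edgeSet)
    else 0

/-! ### Depth-first search with a bounded number of queries -/

/-- A state of the depth-first search: the set of vertices already `done`, the `stack` of active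
vertices, the set of pairs `asked` so far, and the number `hits` of positive answers. -/
structure DfsState (V : Type*) where
  done : Finset V
  stack : List V
  asked : Finset (Sym2 V)
  hits : ℕ

namespace DfsState

variable {V : Type*}

/-- The empty initial state. -/
def initial : DfsState V := ⟨∅, [], ∅, 0⟩

/-- The vertices that the search has not reached yet. -/
def Fresh (s : DfsState V) (v : V) : Prop := v ∉ s.done ∧ v ∉ s.stack

/-- The next pair to be queried: the top of the stack together with a fresh vertex it has not been
tested against. There is none if no such vertex exists or if `N` queries have been made. -/
noncomputable def query (N : ℕ) (s : DfsState V) : Option (V × V) :=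
  match s.stack with
  | [] => none
  | u :: _ =>
    if h : s.asked.card < N ∧ ∃ v, s.Fresh v ∧ s(u, v) ∉ s.asked then some (u, h.2.choose)
    else none

/-- The move of the search that requires no query: retire the top of the stack, or put a fresh
vertex on the empty stack. -/
noncomputable def idle (s : DfsState V) : DfsState V :=
  match s.stack with
  | [] => if h : ∃ v, v ∉ s.done then { s with stack := [h.choose] } else s
  | u :: l => { s with done := insert u s.done, stack := l }

/-- One step of the depth-first search on `G`, which halts after `N` queries. -/
noncomputable def step (N : ℕ) (G : SimpleGraph V) (s : DfsState V) : DfsState V :=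
  match s.query N with
  | some (u, v) =>
    if G.Adj u v then
      { s with stack := v :: s.stack, asked := insert s(u, v) s.asked, hits := s.hits + 1 }
    else { s with asked := insert s(u, v) s.asked }
  | none => if N ≤ s.asked.card then s else s.idle

/-- The state of the search after `t` steps. -/
noncomputable def run (N : ℕ) (G : SimpleGraph V) : ℕ → DfsState V
  | 0 => initial
  | t + 1 => (run N G t).step N G

variable {N : ℕ} {G : SimpleGraph V} {s : DfsState V} {u v : V}

lemma query_eq_some (h : s.query N = some (u, v)) :
    (∃ l, s.stack = u :: l) ∧ s.asked.card < N ∧ s.Fresh v ∧ s(u, v) ∉ s.asked := by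
  unfold query at h
  split at h
  · simp at h
  · rename_i w l hl
    split_ifs at h with h'
    simp only [Option.some.injEq, Prod.mk.injEq] at h
    obtain ⟨rfl, rfl⟩ := h
    exact ⟨⟨l, hl⟩, h'.1, h'.2.choose_spec⟩

lemma ne_of_query_eq_some (h : s.query N = some (u, v)) : u ≠ v := by
  obtain ⟨⟨l, hl⟩, -, hv, -⟩ := query_eq_some h
  rintro rfl
  exact hv.2 (by simp [hl])

lemma step_of_query_eq_some (h : s.query N = some (u, v)) :
    s.step N G = if G.Adj u v then
        { s with stack := v :: s.stack, asked := insert s(u, v) s.asked, hits := s.hits + 1 }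
      else { s with asked := insert s(u, v) s.asked } := by
  simp only [step, h]

lemma step_of_query_eq_none (h : s.query N = none) :
    s.step N G = if N ≤ s.asked.card then s else s.idle := by
  simp only [step, h]

/-- Induction principle along a single step of the search. -/
lemma step_cases {P : DfsState V → Prop} (N : ℕ) (G : SimpleGraph V) (s : DfsState V)
    (halt : N ≤ s.asked.card → P s)
    (full : s.stack = [] → (∀ v, v ∈ s.done) → P s)
    (start : ∀ v, s.stack = [] → v ∉ s.done → P { s with stack := [v] })
    (retire : ∀ u l, s.stack = u :: l → (∀ v, s.Fresh v → s(u, v) ∈ s.asked) →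
      P { s with done := insert u s.done, stack := l })
    (hit : ∀ u v l, s.stack = u :: l → s.asked.card < N → s.Fresh v → s(u, v) ∉ s.asked →
      G.Adj u v →
      P { s with stack := v :: s.stack, asked := insert s(u, v) s.asked, hits := s.hits + 1 })
    (miss : ∀ u v l, s.stack = u :: l → s.asked.card < N → s.Fresh v → s(u, v) ∉ s.asked →
      P { s with asked := insert s(u, v) s.asked }) :
    P (s.step N G) := by
  rcases h : s.query N with _ | ⟨u, v⟩
  · rw [step_of_query_eq_none h]
    split_ifs with hN
    · exact halt hN
    · unfold idle
      split
      · rename_i hs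
        split_ifs with h'
        · exact start _ hs h'.choose_spec
        · exact full hs (by simpa using h')
      · rename_i u l hs
        refine retire u l hs fun v hv ↦ ?_
        by_contra hc
        simp only [query, hs] at h
        rw [dif_pos ⟨not_le.1 hN, v, hv, hc⟩] at h
        simp at h
  · obtain ⟨⟨l, hl⟩, h1, h2, h3⟩ := query_eq_some h
    rw [step_of_query_eq_some h]
    split_ifs with hG
    · exact hit u v l hl h1 h2 h3 hG
    · exact miss u v l hl h1 h2 h3

lemma asked_subset_step : s.asked ⊆ (s.step N G).asked := by
  refine step_cases (P := fun r ↦ s.asked ⊆ r.asked) N G s ?_ ?_ ?_ ?_ ?_ ?_ <;> intros <;> simp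

lemma done_subset_step : s.done ⊆ (s.step N G).done := by
  refine step_cases (P := fun r ↦ s.done ⊆ r.done) N G s ?_ ?_ ?_ ?_ ?_ ?_ <;> intros <;> simp

lemma card_done_step_le : (s.step N G).done.card ≤ s.done.card + 1 := by
  refine step_cases (P := fun r ↦ r.done.card ≤ s.done.card + 1) N G s ?_ ?_ ?_ ?_ ?_ ?_ <;>
    intros <;> simp [Finset.card_insert_le]

lemma asked_step_of_query_eq_none (h : s.query N = none) : (s.step N G).asked = s.asked := by
  rw [step_of_query_eq_none h]
  unfold idle
  split
  · rfl
  · split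
    · split <;> rfl
    · rfl

lemma hits_step_of_query_eq_none (h : s.query N = none) : (s.step N G).hits = s.hits := by
  rw [step_of_query_eq_none h]
  unfold idle
  split
  · rfl
  · split
    · split <;> rfl
    · rfl

lemma card_asked_step_of_query_eq_some (h : s.query N = some (u, v)) :
    (s.step N G).asked.card = s.asked.card + 1 := by
  rw [step_of_query_eq_some h, ← Finset.card_insert_of_notMem (query_eq_some h).2.2.2]
  split_ifs <;> rfl

lemma hits_step_of_query_eq_some (h : s.query N = some (u, v)) :
    (s.step N G).hits = s.hits + if G.Adj u v then 1 else 0 := by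
  rw [step_of_query_eq_some h]
  split_ifs <;> rfl

/-- The search only depends on the status of the pairs it has asked. -/
lemma run_congr {G' : SimpleGraph V} (t : ℕ)
    (h : ∀ u v, s(u, v) ∈ (run N G t).asked → (G.Adj u v ↔ G'.Adj u v)) :
    run N G' t = run N G t := by
  induction t with
  | zero => rfl
  | succ t ih =>
    have hr := ih fun u v huv ↦ h u v (asked_subset_step huv)
    simp only [run] at h ⊢
    rw [hr]
    rcases hq : (run N G t).query N with _ | ⟨u, v⟩
    · rw [step_of_query_eq_none hq, step_of_query_eq_none hq]
    · have := h u v (by rw [step_of_query_eq_some hq]; split_ifs <;> simp)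
      rw [step_of_query_eq_some hq, step_of_query_eq_some hq]
      simp only [this]

/-- The structural invariant of the depth-first search. -/
structure Valid (N : ℕ) (G : SimpleGraph V) (s : DfsState V) : Prop where
  isChain : s.stack.IsChain G.Adj
  nodup : s.stack.Nodup
  disjoint : ∀ v ∈ s.stack, v ∉ s.done
  mem_asked : ∀ u ∈ s.done, ∀ v, s.Fresh v → s(u, v) ∈ s.asked
  hits_le : s.hits ≤ s.done.card + s.stack.length
  card_asked_le : s.asked.card ≤ N

lemma Valid.step (hs : s.Valid N G) : (s.step N G).Valid N G := by
  obtain ⟨h1, h2, h3, h4, h5, h6⟩ := hs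
  refine step_cases N G s ?_ ?_ ?_ ?_ ?_ ?_
  · exact fun _ ↦ ⟨h1, h2, h3, h4, h5, h6⟩
  · exact fun _ _ ↦ ⟨h1, h2, h3, h4, h5, h6⟩
  · intro v hs hv
    refine ⟨by simp, by simp, by simpa using hv, fun a ha b hb ↦ h4 a ha b ⟨hb.1, by simp [hs]⟩,
      ?_, h6⟩
    simp only [hs, List.length_nil, List.length_singleton] at h5 ⊢
    omega
  · intro u l hs hu
    rw [hs] at h1 h2 h3 h5
    rw [List.nodup_cons] at h2
    have hud : u ∉ s.done := h3 u (by simp)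
    refine ⟨h1.of_cons, h2.2, ?_, ?_, ?_, h6⟩
    · intro v hv
      simp only [Finset.mem_insert, not_or]
      exact ⟨fun h ↦ h2.1 (h ▸ hv), h3 v (by simp [hv])⟩
    · intro a ha b hb
      simp only [Fresh, Finset.mem_insert, not_or] at ha hb
      have hb' : s.Fresh b := ⟨hb.1.2, by simp [hs, hb.1.1, hb.2]⟩
      rcases ha with rfl | ha
      · exact hu b hb'
      · exact h4 a ha b hb'
    · simp only [Finset.card_insert_of_notMem hud, List.length_cons] at h5 ⊢
      omega
  · intro u v l hs hN hv hq hG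
    refine ⟨?_, ?_, ?_, ?_, ?_, ?_⟩
    · rw [hs] at h1 ⊢
      exact List.isChain_cons_cons.2 ⟨hG.symm, h1⟩
    · exact List.nodup_cons.2 ⟨hv.2, h2⟩
    · simpa using ⟨hv.1, h3⟩
    · intro a ha b hb
      exact Finset.mem_insert_of_mem (h4 a ha b ⟨hb.1, fun h ↦ hb.2 (List.mem_cons_of_mem _ h)⟩)
    · simp only [List.length_cons]
      omega
    · exact (Finset.card_insert_of_notMem hq).trans_le hN
  · intro u v l hs hN hv hq
    refine ⟨h1, h2, h3, fun a ha b hb ↦ Finset.mem_insert_of_mem (h4 a ha b hb), h5, ?_⟩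
    exact (Finset.card_insert_of_notMem hq).trans_le hN

lemma valid_run (N : ℕ) (G : SimpleGraph V) (t : ℕ) : (run N G t).Valid N G := by
  induction t with
  | zero => constructor <;> simp [run, initial]
  | succ t ih => exact ih.step

lemma Valid.exists_isPath (hs : s.Valid N G) (hne : s.stack ≠ []) :
    ∃ (u v : V) (p : G.Walk u v), p.IsPath ∧ p.length + 1 = s.stack.length := by
  refine ⟨_, _, .ofSupport s.stack hne hs.isChain, ?_, ?_⟩
  · rw [SimpleGraph.Walk.isPath_def, SimpleGraph.Walk.support_ofSupport]
    exact hs.nodup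
  · rw [← SimpleGraph.Walk.length_support, SimpleGraph.Walk.support_ofSupport]

/-- A quantity that increases with every step until the search halts. -/
def progress (s : DfsState V) : ℕ := s.asked.card + 2 * s.done.card + s.stack.length

lemma le_progress_run (N : ℕ) (G : SimpleGraph V) (t : ℕ) :
    t ≤ (run N G t).progress ∨ N ≤ (run N G t).asked.card ∨ ∀ v, v ∈ (run N G t).done := by
  induction t with
  | zero => simp
  | succ t ih =>
    rcases ih with ih | ih | ih
    · have hd := (valid_run N G t).disjoint
      simp only [run]
      unfold progress at ih ⊢
      refine step_cases (P := fun r ↦ t + 1 ≤ r.asked.card + 2 * r.done.card + r.stack.length ∨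
        N ≤ r.asked.card ∨ ∀ v, v ∈ r.done) N G (run N G t) ?_ ?_ ?_ ?_ ?_ ?_
      · exact fun h ↦ .inr (.inl h)
      · exact fun _ h ↦ .inr (.inr h)
      · intro v hs hv
        simp only [hs, List.length_nil, List.length_singleton] at ih ⊢
        omega
      · intro u l hs hu
        simp only [hs, Finset.card_insert_of_notMem (hd u (by simp [hs])), List.length_cons] at ih ⊢
        omega
      · intro u v l hs hN hv hq hG
        simp only [Finset.card_insert_of_notMem hq, List.length_cons]
        omega
      · intro u v l hs hN hv hq
        simp only [Finset.card_insert_of_notMem hq]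
        omega
    · exact .inr (.inl (ih.trans (Finset.card_le_card asked_subset_step)))
    · exact .inr (.inr fun v ↦ done_subset_step (ih v))

section Fintype

variable [Fintype V]

lemma Valid.card_done_add_length_le (hs : s.Valid N G) :
    s.done.card + s.stack.length ≤ Fintype.card V := by
  have hd : Disjoint s.done s.stack.toFinset := by
    rw [Finset.disjoint_left]
    exact fun v hv hv' ↦ hs.disjoint v (by simpa using hv') hv
  rw [← List.toFinset_card_of_nodup hs.nodup, ← Finset.card_union_of_disjoint hd]
  exact Finset.card_le_univ _

lemma Valid.card_done_mul_le (hs : s.Valid N G) :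
    s.done.card * (Fintype.card V - s.done.card - s.stack.length) ≤ N := by
  have hd : Disjoint s.done s.stack.toFinset := by
    rw [Finset.disjoint_left]
    exact fun v hv hv' ↦ hs.disjoint v (by simpa using hv') hv
  have hc : (s.done ∪ s.stack.toFinset)ᶜ.card =
      Fintype.card V - s.done.card - s.stack.length := by
    rw [Finset.card_compl, Finset.card_union_of_disjoint hd,
      List.toFinset_card_of_nodup hs.nodup, Nat.sub_sub]
  rw [← hc, ← Finset.card_product]
  refine le_trans (Finset.card_le_card_of_injOn (fun a ↦ s(a.1, a.2)) ?_ ?_) hs.card_asked_le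
  · rintro ⟨a, b⟩ hab
    simp only [Finset.coe_product, Set.mem_prod, Finset.mem_coe, Finset.mem_compl,
      Finset.mem_union, List.mem_toFinset, not_or] at hab
    exact hs.mem_asked a hab.1 b hab.2
  · rintro ⟨a, b⟩ hab ⟨a', b'⟩ hab' h
    simp only [Finset.coe_product, Set.mem_prod, Finset.mem_coe, Finset.mem_compl,
      Finset.mem_union, List.mem_toFinset, not_or] at hab hab'
    rcases Sym2.eq_iff.1 h with ⟨rfl, rfl⟩ | ⟨rfl, rfl⟩
    · rfl
    · exact absurd hab.1 hab'.2.1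

lemma exists_halted (N : ℕ) (G : SimpleGraph V) :
    N ≤ (run N G (N + 2 * Fintype.card V + 1)).asked.card ∨
      ∀ v, v ∈ (run N G (N + 2 * Fintype.card V + 1)).done := by
  refine (le_progress_run N G _).resolve_left fun h ↦ ?_
  have h1 := (valid_run N G (N + 2 * Fintype.card V + 1)).card_done_add_length_le
  have h2 := (valid_run N G (N + 2 * Fintype.card V + 1)).card_asked_le
  unfold progress at h
  omega

end Fintype

end DfsState

/-! ### Weights of the binomial random graph -/

section Weight

variable {n : ℕ} {p : ℝ}

/-- The probability of the graph `G` in the binomial random graph `G(n,p)`. -/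
noncomputable def erWeight (n : ℕ) (p : ℝ) (G : SimpleGraph (Fin n)) : ℝ :=
  p ^ Nat.card G.edgeSet * (1 - p) ^ (n.choose 2 - Nat.card G.edgeSet)

lemma erProb_eq_sum_erWeight (P : SimpleGraph (Fin n) → Prop) :
    erProb n p P = ∑ G : SimpleGraph (Fin n), if P G then erWeight n p G else 0 := rfl

lemma erWeight_nonneg (hp : 0 ≤ p) (hp' : p ≤ 1) (G : SimpleGraph (Fin n)) :
    0 ≤ erWeight n p G :=
  mul_nonneg (pow_nonneg hp _) (pow_nonneg (sub_nonneg.2 hp') _)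

lemma sum_erWeight (n : ℕ) (p : ℝ) : ∑ G : SimpleGraph (Fin n), erWeight n p G = 1 := by
  have h := Finset.sum_pow_mul_eq_add_pow p (1 - p) (⊤ : SimpleGraph (Fin n)).edgeFinset
  rw [add_sub_cancel, one_pow] at h
  rw [← h]
  refine Finset.sum_bij' (fun G _ ↦ G.edgeFinset)
    (fun A _ ↦ SimpleGraph.fromEdgeSet (A : Set (Sym2 (Fin n)))) ?_ ?_ ?_ ?_ ?_
  · intro G _
    rw [Finset.mem_powerset]
    exact SimpleGraph.edgeFinset_mono le_top
  · simp
  · intro G _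
    simp
  · intro A hA
    rw [Finset.mem_powerset] at hA
    ext e
    have : e ∈ A → ¬ e.IsDiag := fun he ↦ by simpa using hA he
    simpa using this
  · intro G _
    rw [SimpleGraph.card_edgeFinset_top_eq_card_choose_two, Fintype.card_fin, erWeight,
      Nat.card_eq_fintype_card, ← SimpleGraph.edgeFinset_card]

lemma symmDiff_edge_adj {V : Type*} (G : SimpleGraph V) {u v : V} (huv : u ≠ v) (a b : V) :
    (symmDiff G (SimpleGraph.edge u v)).Adj a b ↔
      (s(a, b) = s(u, v) ∧ ¬ G.Adj a b ∨ s(a, b) ≠ s(u, v) ∧ G.Adj a b) := by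
  simp only [symmDiff, SimpleGraph.sup_adj, SimpleGraph.sdiff_adj, SimpleGraph.edge_adj,
    Sym2.eq_iff, ne_eq]
  by_cases h : a = u ∧ b = v ∨ a = v ∧ b = u
  · have : a ≠ b := by rintro rfl; rcases h with ⟨rfl, rfl⟩ | ⟨rfl, rfl⟩ <;> exact huv rfl
    tauto
  · tauto

lemma symmDiff_edge_adj_self {V : Type*} (G : SimpleGraph V) {u v : V} (huv : u ≠ v) :
    (symmDiff G (SimpleGraph.edge u v)).Adj u v ↔ ¬ G.Adj u v := by
  simp [symmDiff_edge_adj G huv]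

lemma erWeight_symmDiff_edge {G : SimpleGraph (Fin n)} {u v : Fin n} (huv : u ≠ v)
    (h : ¬ G.Adj u v) :
    (1 - p) * erWeight n p (symmDiff G (SimpleGraph.edge u v)) = p * erWeight n p G := by
  have hd : symmDiff G (SimpleGraph.edge u v) = G ⊔ SimpleGraph.edge u v := by
    refine Disjoint.symmDiff_eq_sup (SimpleGraph.disjoint_left.2 fun a b hab hab' ↦ h ?_)
    rw [SimpleGraph.edge_adj] at hab'
    rcases hab' with ⟨⟨rfl, rfl⟩ | ⟨rfl, rfl⟩, -⟩
    exacts [hab, hab.symm]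
  have hc : Nat.card (G ⊔ SimpleGraph.edge u v).edgeSet = Nat.card G.edgeSet + 1 := by
    rw [Nat.card_eq_fintype_card, Nat.card_eq_fintype_card, ← SimpleGraph.edgeFinset_card,
      ← SimpleGraph.edgeFinset_card]
    exact G.card_edgeFinset_sup_edge h huv
  have hle : Nat.card (G ⊔ SimpleGraph.edge u v).edgeSet ≤ n.choose 2 := by
    rw [Nat.card_eq_fintype_card, ← SimpleGraph.edgeFinset_card]
    simpa using (G ⊔ SimpleGraph.edge u v).card_edgeFinset_le_card_choose_two
  obtain ⟨m, hm⟩ := Nat.exists_eq_add_of_le (hc ▸ hle)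
  rw [hd, erWeight, erWeight, hc, hm, Nat.add_sub_cancel_left,
    show Nat.card G.edgeSet + 1 + m - Nat.card G.edgeSet = m + 1 by omega]
  ring

/-- An adaptively chosen pair `q G` that does not depend on its own status is present with
probability `p`, independently of anything else that does not depend on its status. -/
lemma sum_erWeight_mul_query (q : SimpleGraph (Fin n) → Option (Fin n × Fin n))
    (F : SimpleGraph (Fin n) → ℝ)
    (hne : ∀ G u v, q G = some (u, v) → u ≠ v)
    (hq : ∀ G u v, q G = some (u, v) → q (symmDiff G (SimpleGraph.edge u v)) = some (u, v))
    (hF : ∀ G u v, q G = some (u, v) → F (symmDiff G (SimpleGraph.edge u v)) = F G) :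
    ∑ G : SimpleGraph (Fin n), erWeight n p G *
      (match q G with
        | none => 0
        | some (u, v) => F G * ((if G.Adj u v then 1 else 0) - p)) = 0 := by
  refine Finset.sum_ninvolution
    (fun G ↦ match q G with
      | none => G
      | some (u, v) => symmDiff G (SimpleGraph.edge u v)) ?_ ?_ (fun _ ↦ Finset.mem_univ _) ?_
  · intro G
    rcases h : q G with _ | ⟨u, v⟩
    · simp [h]
    · have huv := hne G u v h
      simp only [hq G u v h, hF G u v h, symmDiff_edge_adj_self G huv]
      by_cases hG : G.Adj u v
      · have := erWeight_symmDiff_edge (p := p) (G := symmDiff G (SimpleGraph.edge u v)) huv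
          (by simpa [symmDiff_edge_adj_self G huv] using hG)
        rw [symmDiff_symmDiff_cancel_right] at this
        simp only [hG, not_true, if_true, if_false]
        linear_combination F G * this
      · have := erWeight_symmDiff_edge (p := p) huv hG
        simp only [hG, not_false_eq_true, if_true, if_false]
        linear_combination F G * this
  · intro G hG
    rcases h : q G with _ | ⟨u, v⟩
    · simp [h] at hG
    · have huv := hne G u v h
      intro hs
      have := symmDiff_edge_adj_self G huv
      simp only at hs
      rw [hs] at this
      tauto
  · intro G
    rcases h : q G with _ | ⟨u, v⟩
    · simp [h]
    · simp only [hq G u v h, symmDiff_symmDiff_cancel_right]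

end Weight

namespace DfsState

section Deviation

variable {n N : ℕ} {p : ℝ}

/-- The number of positive answers minus its expectation. -/
noncomputable def deviation {V : Type*} (p : ℝ) (s : DfsState V) : ℝ := s.hits - p * s.asked.card

lemma run_symmDiff_edge {V : Type*} {G : SimpleGraph V} {u v : V} {t : ℕ}
    (h : (run N G t).query N = some (u, v)) :
    run N (symmDiff G (SimpleGraph.edge u v)) t = run N G t := by
  refine run_congr t fun a b hab ↦ ?_
  have hne : s(a, b) ≠ s(u, v) := fun he ↦ (query_eq_some h).2.2.2 (he ▸ hab)
  simp [symmDiff_edge_adj G (ne_of_query_eq_some h), hne]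

/-- The variance of the deviation is `p * (1 - p)` times the expected number of queries. -/
lemma sum_erWeight_mul_deviation_sq (n N : ℕ) (p : ℝ) (t : ℕ) :
    ∑ G : SimpleGraph (Fin n), erWeight n p G *
      ((run N G t).deviation p ^ 2 - p * (1 - p) * (run N G t).asked.card) = 0 := by
  induction t with
  | zero => simp [run, initial, deviation]
  | succ t ih =>
    have key := sum_erWeight_mul_query (p := p) (fun G : SimpleGraph (Fin n) ↦ (run N G t).query N)
      (fun G ↦ 2 * (run N G t).deviation p + 1 - 2 * p)
      (fun G u v h ↦ ne_of_query_eq_some h)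
      (fun G u v h ↦ by simpa only [run_symmDiff_edge h] using h)
      (fun G u v h ↦ by simp only [run_symmDiff_edge h])
    rw [← add_zero (0 : ℝ)]
    nth_rewrite 1 [← ih]
    rw [← key, ← Finset.sum_add_distrib]
    refine Finset.sum_congr rfl fun G _ ↦ ?_
    rw [← mul_add]
    congr 1
    simp only [run]
    rcases h : (run N G t).query N with _ | ⟨u, v⟩
    · simp [deviation, hits_step_of_query_eq_none h, asked_step_of_query_eq_none h]
    · simp only [deviation, hits_step_of_query_eq_some h, card_asked_step_of_query_eq_some h]
      split_ifs <;> push_cast <;> ring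

/-- Chebyshev's inequality for the number of positive answers received by the search. -/
lemma sum_erWeight_deviation_le (hp : 0 ≤ p) (hp' : p ≤ 1) (t : ℕ) {c : ℝ} (hc : 0 < c) :
    ∑ G : SimpleGraph (Fin n), (if (run N G t).deviation p ≤ -c then erWeight n p G else 0) ≤
      p * N / c ^ 2 := by
  rw [le_div_iff₀ (by positivity), Finset.sum_mul]
  have h := sum_erWeight_mul_deviation_sq n N p t
  simp only [mul_sub (erWeight n p _), Finset.sum_sub_distrib, sub_eq_zero] at h
  calc _ ≤ ∑ G : SimpleGraph (Fin n), erWeight n p G * (run N G t).deviation p ^ 2 := by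
        refine Finset.sum_le_sum fun G _ ↦ ?_
        have hw := erWeight_nonneg hp hp' G
        split_ifs with hd
        · gcongr ?_ * ?_
          nlinarith
        · rw [zero_mul]
          positivity
    _ = _ := h
    _ ≤ ∑ G : SimpleGraph (Fin n), erWeight n p G * (p * N) := by
        refine Finset.sum_le_sum fun G _ ↦ ?_
        have hw := erWeight_nonneg hp hp' G
        have hN : ((run N G t).asked.card : ℝ) ≤ N := by
          exact_mod_cast (valid_run N G t).card_asked_le
        have : p * (1 - p) ≤ p := by nlinarith
        gcongr
    _ = p * N := by rw [← Finset.sum_mul, sum_erWeight, one_mul]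

end Deviation

end DfsState

namespace DfsState

section Deterministic

variable {n N : ℕ} {ε : ℝ} {G : SimpleGraph (Fin n)}

/-- If the stack is always short, then few vertices are done before the queries run out. -/
lemma three_mul_card_done_run_le (hε : 0 < ε) (hε' : ε < 1 / 20) (hn : 4 ≤ n)
    (hN : (N : ℝ) ≤ ε * n ^ 2 / 2)
    (hstack : ∀ t, ((run N G t).stack.length : ℝ) ≤ ε ^ 2 * n / 5) (t : ℕ) :
    3 * (run N G t).done.card ≤ n := by
  induction t with
  | zero => simp [run, initial]
  | succ t ih =>
    have hv := valid_run N G t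
    have h1 := hv.card_done_mul_le
    have h2 := hv.card_done_add_length_le
    have h3 := hstack t
    rw [Fintype.card_fin] at h1 h2
    rw [Nat.sub_sub] at h1
    have h4 : ((run N G t).done.card : ℝ) *
        (n - ((run N G t).done.card + (run N G t).stack.length)) ≤ N := by
      have := (Nat.cast_le (α := ℝ)).2 h1
      push_cast [Nat.cast_sub h2] at this
      exact this
    have h5 : (run N G (t + 1)).done.card ≤ (run N G t).done.card + 1 := card_done_step_le
    have ih' : 3 * ((run N G t).done.card : ℝ) ≤ n := by exact_mod_cast ih
    have hn' : (4 : ℝ) ≤ n := by exact_mod_cast hn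
    generalize ((run N G t).done.card) = s at *
    generalize ((run N G t).stack.length) = l at *
    have hl : (l : ℝ) ≤ n / 6 := by nlinarith
    have hs0 : (0 : ℝ) ≤ s := by positivity
    have h6 : (s : ℝ) * (n / 2) ≤ ε * n ^ 2 / 2 := by nlinarith
    have h7 : (s : ℝ) ≤ ε * n := by
      have : (0 : ℝ) < n := by linarith
      nlinarith
    have h8 : (s : ℝ) ≤ n / 20 := by nlinarith
    have h9 : 20 * s ≤ n := by
      have : (20 : ℝ) * s ≤ n := by linarith
      exact_mod_cast this
    omega

/-- If the stack is always short, then the search has received few positive answers when it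
halts. -/
lemma deviation_run_le (hε : 0 < ε) (hε' : ε < 1 / 20) (hn : 200 / ε ^ 2 ≤ n)
    (hN : (N : ℝ) ≤ ε * n ^ 2 / 2) (hN' : ε * n ^ 2 / 2 < N + 1)
    (hstack : ∀ t, ((run N G t).stack.length : ℝ) ≤ ε ^ 2 * n / 5) :
    (run N G (N + 2 * n + 1)).deviation ((1 + ε) / n) ≤ -(ε ^ 2 / 100 * n) := by
  have hn1 : 200 ≤ ε ^ 2 * n := by
    rw [div_le_iff₀ (by positivity)] at hn
    linarith
  have hn0 : (200 : ℝ) ≤ n := by nlinarith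
  have hn4 : 4 ≤ n := by
    have : (4 : ℝ) ≤ n := by linarith
    exact_mod_cast this
  set r := run N G (N + 2 * n + 1) with hr
  have hv : r.Valid N G := valid_run N G _
  have h3 := three_mul_card_done_run_le hε hε' hn4 hN hstack (N + 2 * n + 1)
  rw [← hr] at h3
  have hasked : r.asked.card = N := by
    refine le_antisymm hv.card_asked_le ?_
    have := exists_halted N G
    rw [Fintype.card_fin, ← hr] at this
    refine this.resolve_right fun h ↦ ?_
    rw [Finset.eq_univ_iff_forall.2 h, Finset.card_univ, Fintype.card_fin] at h3
    omega
  have h1 := hv.card_done_mul_le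
  have h2 := hv.card_done_add_length_le
  have h4 := hstack (N + 2 * n + 1)
  have h5 := hv.hits_le
  rw [Fintype.card_fin] at h1 h2
  rw [Nat.sub_sub] at h1
  rw [← hr] at h4
  have h6 : (r.done.card : ℝ) * (n - (r.done.card + r.stack.length)) ≤ N := by
    have := (Nat.cast_le (α := ℝ)).2 h1
    push_cast [Nat.cast_sub h2] at this
    exact this
  have h3' : 3 * (r.done.card : ℝ) ≤ n := by exact_mod_cast h3
  have h5' : (r.hits : ℝ) ≤ r.done.card + r.stack.length := by exact_mod_cast h5
  by_contra! hdev
  rw [deviation, hasked] at hdev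
  have hpN : (ε + ε ^ 2) * n / 2 - 2 ≤ (1 + ε) / n * N := by
    have hnpos : (0 : ℝ) < n := by linarith
    rw [div_mul_eq_mul_div, le_div_iff₀ hnpos]
    nlinarith
  generalize (r.done.card : ℝ) = s at *
  generalize (r.stack.length : ℝ) = l at *
  generalize (r.hits : ℝ) = k at *
  generalize (1 + ε) / n * N = m at *
  generalize (N : ℝ) = M at *
  generalize (n : ℝ) = x at *
  have hs : (ε / 2 + 28 / 100 * ε ^ 2) * x ≤ s := by nlinarith
  have hε2 : ε ^ 2 ≤ 1 / 20 * ε := by nlinarith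
  have hs0 : 0 ≤ s := le_trans (by positivity) hs
  have h7 : s * (x - s - ε ^ 2 * x / 5) ≤ ε * x ^ 2 / 2 := by nlinarith
  have h8 : 0 ≤ x - s - (ε / 2 + 28 / 100 * ε ^ 2) * x - ε ^ 2 * x / 5 := by nlinarith
  have h9 := mul_nonneg (sub_nonneg.2 hs) h8
  have h10 : (ε / 2 + 28 / 100 * ε ^ 2) * (1 - (ε / 2 + 28 / 100 * ε ^ 2) - ε ^ 2 / 5) ≤ ε / 2 := by
    refine le_of_mul_le_mul_right ?_ (show 0 < x ^ 2 by positivity)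
    linear_combination h7 + h9
  have h11 : 0 < ε ^ 2 * (3 / 100 - ε * (38 / 100) - 1344 / 10000 * ε ^ 2) := by
    refine mul_pos (by positivity) ?_
    nlinarith
  nlinarith

end Deterministic

end DfsState

/-- A lower bound for the probability that the binomial random graph contains a long path. -/
lemma one_sub_le_erProb_exists_isPath {n : ℕ} {ε : ℝ} (hε : 0 < ε) (hε' : ε < 1 / 20)
    (hn : 200 / ε ^ 2 ≤ n) :
    1 - 10000 / ε ^ 4 / n ≤ erProb n ((1 + ε) / n)
      (fun G => ∃ (u v : Fin n) (p : G.Walk u v), p.IsPath ∧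
        ε ^ 2 * n / 5 ≤ ((p.length + 1 : ℕ) : ℝ)) := by
  have hn1 : 200 ≤ ε ^ 2 * n := by
    rw [div_le_iff₀ (by positivity)] at hn
    linarith
  have hn0 : (200 : ℝ) ≤ n := by nlinarith
  have hnpos : (0 : ℝ) < n := by linarith
  have hp0 : 0 ≤ (1 + ε) / n := by positivity
  have hp1 : (1 + ε) / n ≤ 1 := by
    rw [div_le_one hnpos]
    linarith
  set N := ⌊ε * (n : ℝ) ^ 2 / 2⌋₊ with hN
  have hN1 : (N : ℝ) ≤ ε * n ^ 2 / 2 := Nat.floor_le (by positivity)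
  have hN2 : ε * (n : ℝ) ^ 2 / 2 < N + 1 := Nat.lt_floor_add_one _
  have hcheb := DfsState.sum_erWeight_deviation_le (n := n) (N := N) hp0 hp1 (N + 2 * n + 1)
    (c := ε ^ 2 / 100 * n) (by positivity)
  have hbound : (1 + ε) / n * N / (ε ^ 2 / 100 * n) ^ 2 ≤ 10000 / ε ^ 4 / n := by
    have : (1 + ε) / n * N ≤ n := by
      rw [div_mul_eq_mul_div, div_le_iff₀ hnpos]
      nlinarith
    calc _ ≤ n / (ε ^ 2 / 100 * n) ^ 2 := by gcongr
      _ = 10000 / ε ^ 4 / n := by field_simp; norm_num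
  rw [erProb_eq_sum_erWeight]
  refine (sub_le_sub_left (hcheb.trans hbound) 1).trans ?_
  rw [sub_le_iff_le_add, ← Finset.sum_add_distrib]
  refine (sum_erWeight n ((1 + ε) / n)).ge.trans ?_
  refine Finset.sum_le_sum fun G _ ↦ ?_
  have hw := erWeight_nonneg hp0 hp1 G
  split_ifs with h1 h2 h2
  · linarith
  · linarith
  · linarith
  · refine absurd (DfsState.deviation_run_le hε hε' hn hN1 hN2 fun t ↦ ?_) h2
    by_contra! hlong
    have hne : (DfsState.run N G t).stack ≠ [] := by
      rintro h
      rw [h, List.length_nil, Nat.cast_zero] at hlong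
      exact hlong.not_ge (by positivity)
    obtain ⟨u, v, q, hq, hlen⟩ := (DfsState.valid_run N G t).exists_isPath hne
    exact h1 ⟨u, v, q, hq, hlen ▸ hlong.le⟩

lemma erProb_le_one {n : ℕ} {p : ℝ} (hp : 0 ≤ p) (hp' : p ≤ 1) (P : SimpleGraph (Fin n) → Prop) :
    erProb n p P ≤ 1 := by
  rw [erProb_eq_sum_erWeight, ← sum_erWeight n p]
  refine Finset.sum_le_sum fun G _ ↦ ?_
  have := erWeight_nonneg hp hp' G
  split_ifs <;> linarith

theorem stmt_16 :
    ∃ ε₀ : ℝ, 0 < ε₀ ∧ ∀ ε : ℝ, 0 < ε → ε < ε₀ →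
      Tendsto
        (fun n : ℕ => erProb n ((1 + ε) / n)
          (fun G => ∃ (u v : Fin n) (p : G.Walk u v), p.IsPath ∧
            ε ^ 2 * n / 5 ≤ ((p.length + 1 : ℕ) : ℝ)))
        atTop (nhds 1) := by
  refine ⟨1 / 20, by norm_num, fun ε hε hε' ↦ ?_⟩
  have hlim : Tendsto (fun n : ℕ ↦ 1 - 10000 / ε ^ 4 / (n : ℝ)) atTop (nhds 1) := by
    have h := (tendsto_const_div_atTop_nhds_zero_nat (10000 / ε ^ 4)).const_sub 1
    rwa [sub_zero] at h
  refine tendsto_of_tendsto_of_tendsto_of_le_of_le' hlim tendsto_const_nhds ?_ ?_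
  · filter_upwards [tendsto_natCast_atTop_atTop.eventually_ge_atTop (200 / ε ^ 2)] with n hn
    exact one_sub_le_erProb_exists_isPath hε hε' hn
  · filter_upwards [eventually_ge_atTop 2] with n hn
    have hn' : (2 : ℝ) ≤ n := by exact_mod_cast hn
    refine erProb_le_one (by positivity) ?_ _
    rw [div_le_one (by linarith)]
    linarith
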